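/- arXiv:math/0309192 — 2 statements merged into one kernel-verified Lean document; each statement's English description precedes it below -/
import Mathlib

section
/- Let X be a labeled graph. If the BKN-equation over X has a compatible symmetric solution, then it has a compatible symmetric solution (a',γ') satisfying one of the following two conditions: (1) (a',γ') is an NPC-solution; (2) γ' takes values only in {0,1,−1} and |γ'_w| = 1 for every edge w ∈ W with a'_{w⁻}·a'_{w⁺} ≠ 0. Moreover, if the BKN-equation over X has a compatible symmetric solution whose length function is positive (a_v > 0 for all v ∈ V), then it has a compatible symmetric solution (a',γ') satisfying (1) or the condition (3): a'_v > 0 for all v ∈ V and γ' takes values only in {0,1,−1}. -/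
open Finset Matrix

/-- A labeled graph `X = (Γ, |B|, K)`: a finite connected graph with oriented edge set `W`
(carrying the fixed-point-free orientation-reversal involution `rev` and initial-vertex map
`ini`), positive integer weights `b` on oriented edges with `b (rev w) = b w`, and real
charges `k` on vertices. -/
structure LabeledGraph (V W : Type) [Fintype V] [DecidableEq V] [Fintype W] [DecidableEq W] where
  rev : W → W
  rev_invol : ∀ w, rev (rev w) = w
  rev_ne : ∀ w, rev w ≠ w
  ini : W → V
  b : W → ℕ
  b_pos : ∀ w, 0 < b w
  b_symm : ∀ w, b (rev w) = b w
  k : V → ℝ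
  edges_nonempty : Nonempty W
  connected : ∀ u v : V,
    Relation.ReflTransGen (fun x y => ∃ w, ini w = x ∧ ini (rev w) = y) u v

namespace LabeledGraph

variable {V W : Type} [Fintype V] [DecidableEq V] [Fintype W] [DecidableEq W]

/-- The terminal vertex `w⁺ = (-w)⁻` of an oriented edge. -/
def ter (X : LabeledGraph V W) (w : W) : V := X.ini (X.rev w)

/-- The BKN-equation over `X`: `k_v · a_v = Σ_{w ∈ ∂v} (γ_w/|b_w|) · a_{w⁺}` for all `v`. -/
def BKN (X : LabeledGraph V W) (a : V → ℝ) (γ : W → ℝ) : Prop :=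
  ∀ v : V, X.k v * a v =
    ∑ w ∈ univ.filter (fun w => X.ini w = v), γ w / (X.b w : ℝ) * a (X.ter w)

/-- Compatibility of a solution `(a,γ)`. -/
def Compatible (X : LabeledGraph V W) (a : V → ℝ) (γ : W → ℝ) : Prop :=
  (∀ v, 0 ≤ a v) ∧ a ≠ 0 ∧ (∀ w, |γ w| ≤ 1) ∧
    (∀ w, |γ w * γ (X.rev w)| = 1 → γ (X.rev w) = γ w) ∧
    (∀ v, a v = 0 → ∀ w, X.ini w = v → γ w = 0 ∧ γ (X.rev w) = 0)

/-- The angle function is symmetric: `γ_{-w} = γ_w`. -/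
def SymSol (X : LabeledGraph V W) (γ : W → ℝ) : Prop := ∀ w, γ (X.rev w) = γ w

/-- An NPC-solution: a compatible symmetric solution with positive length function and
`|γ| < 1`. -/
def NPCSolution (X : LabeledGraph V W) (a : V → ℝ) (γ : W → ℝ) : Prop :=
  X.BKN a γ ∧ X.Compatible a γ ∧ X.SymSol γ ∧ (∀ v, 0 < a v) ∧ ∀ w, |γ w| < 1

/-- The operator `A⁺ = D⁺ − J` on `ℝ^V`. -/
noncomputable def Aplus (X : LabeledGraph V W) : Matrix V V ℝ :=
  Matrix.of fun v v' =>
    (if v = v' then |X.k v| else 0)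
      - ∑ w ∈ univ.filter (fun w => X.ini w = v ∧ X.ter w = v'), (1 : ℝ) / (X.b w)

/-- The operator `A_λ = D − J_λ` on `ℝ^V` for a (symmetric `±1`-valued) function `λ` on `W`. -/
noncomputable def Aop (X : LabeledGraph V W) (lam : W → ℝ) : Matrix V V ℝ :=
  Matrix.of fun v v' =>
    (if v = v' then X.k v else 0)
      - ∑ w ∈ univ.filter (fun w => X.ini w = v ∧ X.ter w = v'), lam w / (X.b w : ℝ)

/-- Two vertices lie in the same sign component. -/
def SameSign (X : LabeledGraph V W) : V → V → Prop :=
  Relation.ReflTransGen fun x y =>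
    (∃ w, X.ini w = x ∧ X.ter w = y) ∧ 0 < X.k x * X.k y

/-- A `±1`-valued sign function `s` of type (ii): constant on sign components, alternating
along edges joining distinct sign components, and equal to `1` at some vertex of positive
charge. -/
def TypeII (X : LabeledGraph V W) (s : V → ℝ) : Prop :=
  (∀ v, s v = 1 ∨ s v = -1) ∧
    (∀ u v, X.SameSign u v → s u = s v) ∧
    (∀ w, ¬ X.SameSign (X.ini w) (X.ter w) → s (X.ini w) = - s (X.ter w)) ∧
    (∃ v, s v = 1 ∧ 0 < X.k v)

/-- An admissible sign function: of type (ii), or identically zero when no type (ii)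
function exists. -/
def Admissible (X : LabeledGraph V W) (s : V → ℝ) : Prop :=
  X.TypeII s ∨ (s = 0 ∧ ¬ ∃ s', X.TypeII s')

open scoped Classical in
/-- The operator `H = D_s − J₀` associated with an admissible sign function `s`; only
oriented edges with both endpoints in one and the same sign component contribute. -/
noncomputable def Hop (X : LabeledGraph V W) (s : V → ℝ) : Matrix V V ℝ :=
  Matrix.of fun v v' =>
    (if v = v' then s v * X.k v else 0)
      - ∑ w ∈ univ.filter
          (fun w => X.ini w = v ∧ X.ter w = v' ∧ X.SameSign (X.ini w) (X.ter w)),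
          (1 : ℝ) / (X.b w)

/-- `A` has a nonpositive real eigenvalue. -/
def HasNonposEigenvalue (A : Matrix V V ℝ) : Prop :=
  ∃ μ : ℝ, μ ≤ 0 ∧ ∃ x : V → ℝ, x ≠ 0 ∧ A.mulVec x = μ • x

/-- `A` has a negative real eigenvalue. -/
def HasNegEigenvalue (A : Matrix V V ℝ) : Prop :=
  ∃ μ : ℝ, μ < 0 ∧ ∃ x : V → ℝ, x ≠ 0 ∧ A.mulVec x = μ • x

/-- `A` is positive semidefinite: `(Ax,x) ≥ 0` for all `x`. -/
def PosSemidef' (A : Matrix V V ℝ) : Prop := ∀ x : V → ℝ, 0 ≤ x ⬝ᵥ A.mulVec x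

/-- `A` is singular: it has a nontrivial kernel. -/
def Singular (A : Matrix V V ℝ) : Prop := ∃ x : V → ℝ, x ≠ 0 ∧ A.mulVec x = 0

/-- `A` is supersingular: its kernel contains a vector with all coordinates nonzero. -/
def Supersingular (A : Matrix V V ℝ) : Prop :=
  ∃ x : V → ℝ, (∀ v, x v ≠ 0) ∧ A.mulVec x = 0

/-- `A` is weakly singular: there is a nonzero `x` with `(Ax)_v = 0` at every vertex of the
support of `x`. -/
def WeaklySingular (A : Matrix V V ℝ) : Prop :=
  ∃ x : V → ℝ, x ≠ 0 ∧ ∀ v, x v ≠ 0 → A.mulVec x v = 0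

end LabeledGraph

namespace LabeledGraph

variable {V W : Type} [Fintype V] [DecidableEq V] [Fintype W] [DecidableEq W]
  (X : LabeledGraph V W)

/-- The sum of a function on oriented edges over the edges starting at a vertex. -/
def outSum (y : W → ℝ) (v : V) : ℝ := ∑ w ∈ univ.filter (fun w => X.ini w = v), y w

/-- The quadratic coordinates `p_v = a_v²`, `y_w = γ_w a_{w⁻} a_{w⁺} / |b_w|` turn compatible
symmetric solutions of the BKN-equation into points of a convex cone. -/
structure Feasible (p : V → ℝ) (y : W → ℝ) : Prop where
  nonneg : ∀ v, 0 ≤ p v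
  symm : ∀ w, y (X.rev w) = y w
  bound : ∀ w, (X.b w * y w) ^ 2 ≤ p (X.ini w) * p (X.ter w)
  eqn : ∀ v, X.k v * p v = X.outSum y v

/-- The bound on the edge `w` is strict. -/
def Slack (p : V → ℝ) (y : W → ℝ) (w : W) : Prop :=
  (X.b w * y w) ^ 2 < p (X.ini w) * p (X.ter w)

variable {X}

lemma ini_rev (w : W) : X.ini (X.rev w) = X.ter w := rfl

lemma ter_rev (w : W) : X.ter (X.rev w) = X.ini w := by
  simp [ter, X.rev_invol]

lemma rev_eq_iff {w w' : W} : X.rev w = w' ↔ w = X.rev w' :=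
  ⟨fun h => by rw [← h, X.rev_invol], fun h => by rw [h, X.rev_invol]⟩

lemma sum_rev (f : W → ℝ) : ∑ w, f (X.rev w) = ∑ w, f w :=
  Equiv.sum_comp (Function.Involutive.toPerm X.rev X.rev_invol) f

lemma sum_mul_outSum (g : V → ℝ) (y : W → ℝ) :
    ∑ v, g v * X.outSum y v = ∑ w, g (X.ini w) * y w := by
  rw [← Finset.sum_fiberwise univ X.ini]
  refine Finset.sum_congr rfl fun v _ => ?_
  rw [outSum, Finset.mul_sum]
  refine Finset.sum_congr rfl fun w hw => ?_
  rw [(Finset.mem_filter.1 hw).2]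

lemma outSum_add (y z : W → ℝ) (v : V) :
    X.outSum (fun w => y w + z w) v = X.outSum y v + X.outSum z v :=
  Finset.sum_add_distrib

lemma outSum_sub (y z : W → ℝ) (v : V) :
    X.outSum (fun w => y w - z w) v = X.outSum y v - X.outSum z v :=
  Finset.sum_sub_distrib _ _

lemma outSum_const_mul (c : ℝ) (y : W → ℝ) (v : V) :
    X.outSum (fun w => c * y w) v = c * X.outSum y v :=
  (Finset.mul_sum _ _ _).symm

lemma outSum_ini_mul (g : V → ℝ) (y : W → ℝ) (v : V) :
    X.outSum (fun w => g (X.ini w) * y w) v = g v * X.outSum y v := by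
  rw [outSum, outSum, Finset.mul_sum]
  refine Finset.sum_congr rfl fun w hw => ?_
  rw [(Finset.mem_filter.1 hw).2]

/-- The weighted Laplacian is symmetric. -/
lemma sum_mul_laplacian {y : W → ℝ} (hy : ∀ w, y (X.rev w) = y w) (x β : V → ℝ) :
    ∑ v, x v * X.outSum (fun w => y w * (β (X.ini w) - β (X.ter w))) v =
      ∑ v, β v * X.outSum (fun w => y w * (x (X.ini w) - x (X.ter w))) v := by
  rw [sum_mul_outSum, sum_mul_outSum]
  have h := X.sum_rev (fun w => y w * (x (X.ini w) * β (X.ter w)))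
  simp only [hy, ini_rev, ter_rev] at h
  rw [← sub_eq_zero, ← Finset.sum_sub_distrib, ← sub_eq_zero.2 h, ← Finset.sum_sub_distrib]
  exact Finset.sum_congr rfl fun w _ => by ring

lemma slack_rev {p : V → ℝ} {y : W → ℝ} (hy : ∀ w, y (X.rev w) = y w) (w : W) :
    X.Slack p y (X.rev w) ↔ X.Slack p y w := by
  rw [Slack, Slack, X.b_symm, hy, ini_rev, ter_rev, mul_comm (p (X.ter w))]

lemma b_pos_real (w : W) : (0 : ℝ) < X.b w := Nat.cast_pos.2 (X.b_pos w)

namespace Feasible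

variable {p : V → ℝ} {y : W → ℝ}

lemma eq_zero (h : X.Feasible p y) {w : W} (hw : p (X.ini w) * p (X.ter w) = 0) : y w = 0 := by
  have h1 := h.bound w
  rw [hw] at h1
  have h2 : (X.b w : ℝ) * y w = 0 := by nlinarith
  exact (mul_eq_zero.1 h2).resolve_left (X.b_pos_real w).ne'

lemma pos_of_slack (h : X.Feasible p y) {w : W} (hw : X.Slack p y w) :
    0 < p (X.ini w) ∧ 0 < p (X.ter w) := by
  have h1 : 0 < p (X.ini w) * p (X.ter w) := (sq_nonneg _).trans_lt hw
  exact ⟨pos_of_mul_pos_left h1 (h.nonneg _), pos_of_mul_pos_right h1 (h.nonneg _)⟩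

/-- Return from quadratic coordinates to lengths and angles. -/
lemma exists_solution (h : X.Feasible p y) (hp : ∃ v, 0 < p v) :
    ∃ (a : V → ℝ) (γ : W → ℝ), X.BKN a γ ∧ X.Compatible a γ ∧ X.SymSol γ ∧
      (∀ v, a v = √(p v)) ∧
      ∀ w, γ w ^ 2 * (p (X.ini w) * p (X.ter w)) = (X.b w * y w) ^ 2 ∧ (y w = 0 → γ w = 0) := by
  let a : V → ℝ := fun v => √(p v)
  let γ : W → ℝ := fun w => X.b w * y w / (a (X.ini w) * a (X.ter w))
  have ha : ∀ v, a v ^ 2 = p v := fun v => Real.sq_sqrt (h.nonneg v)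
  have ha0 : ∀ v, 0 ≤ a v := fun v => Real.sqrt_nonneg _
  have hzero : ∀ w, a (X.ini w) * a (X.ter w) = 0 → y w = 0 := fun w hw =>
    h.eq_zero (by rw [← ha, ← ha, ← mul_pow, hw]; simp)
  have hγ : ∀ w, γ w * (a (X.ini w) * a (X.ter w)) = X.b w * y w := by
    intro w
    by_cases hw : a (X.ini w) * a (X.ter w) = 0
    · simp [hw, hzero w hw]
    · exact div_mul_cancel₀ _ hw
  have hsym : X.SymSol γ := by
    intro w
    simp only [γ, X.b_symm, h.symm, ini_rev, ter_rev, mul_comm (a (X.ter w))]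
  have hγ0 : ∀ w, y w = 0 → γ w = 0 := fun w hw => by simp [γ, hw]
  have hsq : ∀ w, γ w ^ 2 * (p (X.ini w) * p (X.ter w)) = (X.b w * y w) ^ 2 := fun w => by
    rw [← hγ, mul_pow, mul_pow, ha, ha]
  refine ⟨a, γ, ?_, ⟨ha0, ?_, ?_, fun w _ => hsym w, ?_⟩, hsym, fun _ => rfl,
    fun w => ⟨hsq w, hγ0 w⟩⟩
  · intro v
    rcases (ha0 v).eq_or_lt' with hv | hv
    · rw [hv, mul_zero, Finset.sum_eq_zero]
      intro w hw
      rw [hγ0 w (hzero w (by rw [(Finset.mem_filter.1 hw).2, hv, zero_mul]))]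
      simp
    · apply mul_right_cancel₀ hv.ne'
      have := h.eqn v
      rw [mul_assoc, ← sq, ha, this, outSum, Finset.sum_mul]
      refine Finset.sum_congr rfl fun w hw => ?_
      have h1 := hγ w
      rw [(Finset.mem_filter.1 hw).2] at h1
      have := (X.b_pos_real w).ne'
      field_simp
      linarith
  · obtain ⟨v, hv⟩ := hp
    exact fun h0 => (Real.sqrt_pos.2 hv).ne' (congrFun h0 v)
  · intro w
    by_cases hw : a (X.ini w) * a (X.ter w) = 0
    · simp [hγ0 w (hzero w hw)]
    · rw [← sq_le_one_iff_abs_le_one]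
      have h1 : 0 < (a (X.ini w) * a (X.ter w)) ^ 2 := by positivity
      rw [mul_pow, ha, ha] at h1
      have := h.bound w
      rw [← hsq w] at this
      exact le_of_mul_le_mul_right (by linarith) h1
  · intro v hv w hw
    have : γ w = 0 := hγ0 w (hzero w (by rw [hw, hv, zero_mul]))
    exact ⟨this, by rw [hsym, this]⟩

/-- Rescaling lengths by `1 + t x`, with `x` harmonic for the weights `y`. -/
lemma rescale (h : X.Feasible p y) {x : V → ℝ}
    (hx : ∀ v, X.outSum (fun w => y w * (x (X.ini w) - x (X.ter w))) v = 0) (t : ℝ) :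
    X.Feasible (fun v => (1 + t * x v) ^ 2 * p v)
      (fun w => (1 + t * x (X.ini w)) * (1 + t * x (X.ter w)) * y w) where
  nonneg v := mul_nonneg (sq_nonneg _) (h.nonneg v)
  symm w := by rw [h.symm, ini_rev, ter_rev]; ring
  bound w := by
    have := mul_le_mul_of_nonneg_left (h.bound w)
      (sq_nonneg ((1 + t * x (X.ini w)) * (1 + t * x (X.ter w))))
    linarith
  eqn v := by
    have h1 : (fun w => (1 + t * x (X.ini w)) * (1 + t * x (X.ter w)) * y w) =
        fun w => (fun v => 1 + t * x v) (X.ini w) *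
          ((fun v => 1 + t * x v) (X.ini w) * y w - t * (y w * (x (X.ini w) - x (X.ter w)))) := by
      funext w; ring
    rw [h1, X.outSum_ini_mul (fun v => 1 + t * x v), outSum_sub, outSum_const_mul, hx,
      X.outSum_ini_mul (fun v => 1 + t * x v), ← h.eqn]
    ring

lemma add {p' : V → ℝ} {y' : W → ℝ} (h : X.Feasible p y) (h' : X.Feasible p' y') :
    X.Feasible (fun v => p v + p' v) (fun w => y w + y' w) where
  nonneg v := add_nonneg (h.nonneg v) (h'.nonneg v)
  symm w := by rw [h.symm, h'.symm]
  bound w := by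
    have h1 := h.bound w
    have h2 := h'.bound w
    have hp := h.nonneg (X.ini w)
    have hq := h.nonneg (X.ter w)
    have hp' := h'.nonneg (X.ini w)
    have hq' := h'.nonneg (X.ter w)
    have h3 : X.b w * y w * (X.b w * y' w) ≤
        (p (X.ini w) * p' (X.ter w) + p' (X.ini w) * p (X.ter w)) / 2 := by
      apply le_of_sq_le_sq _ (by positivity)
      have := mul_le_mul h1 h2 (sq_nonneg _) (mul_nonneg hp hq)
      nlinarith [sq_nonneg (p (X.ini w) * p' (X.ter w) - p' (X.ini w) * p (X.ter w))]
    nlinarith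
  eqn v := by rw [outSum_add, ← h.eqn, ← h'.eqn]; ring

end Feasible

/-- A solution gives a feasible point. -/
lemma exists_feasible {a : V → ℝ} {γ : W → ℝ} (h : X.BKN a γ) (hc : X.Compatible a γ)
    (hs : X.SymSol γ) : ∃ y, X.Feasible (fun v => a v ^ 2) y := by
  refine ⟨fun w => a (X.ini w) * (γ w / X.b w * a (X.ter w)), fun v => sq_nonneg _, ?_, ?_, ?_⟩
  · intro w
    rw [hs, X.b_symm, ini_rev, ter_rev]; ring
  · intro w
    have hb := (X.b_pos_real w).ne'
    have h1 : (X.b w : ℝ) * (a (X.ini w) * (γ w / X.b w * a (X.ter w))) =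
      γ w * (a (X.ini w) * a (X.ter w)) := by field_simp
    have h2 : γ w ^ 2 ≤ 1 := (sq_le_one_iff_abs_le_one _).2 (hc.2.2.1 w)
    rw [h1, mul_pow, ← mul_pow (a _)]
    exact mul_le_of_le_one_left (sq_nonneg _) h2
  · intro v
    rw [X.outSum_ini_mul a, outSum, ← h v]; ring

lemma eventually_quadratic_pos {c l m : ℝ} (h : 0 < c ∨ c = 0 ∧ (0 < l ∨ l = 0 ∧ 0 < m)) :
    ∀ᶠ ε : ℝ in nhdsWithin 0 (Set.Ioi 0), 0 < c + ε * (l + ε * m) := by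
  have key : ∀ r s : ℝ, 0 < r → ∀ᶠ ε : ℝ in nhdsWithin 0 (Set.Ioi 0), 0 < r + ε * s := by
    intro r s hr
    apply Filter.Eventually.filter_mono nhdsWithin_le_nhds
    have : ContinuousAt (fun ε : ℝ => r + ε * s) 0 := by fun_prop
    exact this.eventually (lt_mem_nhds (by simpa using hr))
  have hpos : ∀ᶠ ε : ℝ in nhdsWithin 0 (Set.Ioi 0), 0 < ε := self_mem_nhdsWithin
  rcases h with h | ⟨rfl, h | ⟨rfl, h⟩⟩
  · apply Filter.Eventually.filter_mono nhdsWithin_le_nhds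
    have : ContinuousAt (fun ε : ℝ => c + ε * (l + ε * m)) 0 := by fun_prop
    exact this.eventually (lt_mem_nhds (by simpa using h))
  · filter_upwards [key l m h, hpos] with ε h1 h2
    rw [zero_add]; positivity
  · filter_upwards [hpos] with ε h2
    rw [zero_add, zero_add]; positivity

/-- Moving from a feasible point in an admissible direction `(q, z)`. -/
lemma Feasible.exists_perturbation {p q : V → ℝ} {y z : W → ℝ} (h : X.Feasible p y)
    (hz : ∀ w, z (X.rev w) = z w) (hqz : ∀ v, X.k v * q v = X.outSum z v)
    (hq : ∀ v, p v = 0 → 0 ≤ q v)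
    (hedge : ∀ w, (p (X.ini w) = 0 ∧ q (X.ini w) = 0 ∨ p (X.ter w) = 0 ∧ q (X.ter w) = 0) ∧
        z w = 0 ∨
      X.Slack p y w ∨
      0 < q (X.ini w) * p (X.ter w) + p (X.ini w) * q (X.ter w) - 2 * X.b w ^ 2 * y w * z w ∨
      (q (X.ini w) * p (X.ter w) + p (X.ini w) * q (X.ter w) - 2 * X.b w ^ 2 * y w * z w = 0 ∧
        (X.b w * z w) ^ 2 < q (X.ini w) * q (X.ter w))) :
    ∃ (p' : V → ℝ) (y' : W → ℝ), X.Feasible p' y' ∧ (∀ v, 0 < p' v ↔ 0 < p v ∨ 0 < q v) ∧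
      ∀ w, 0 < p' (X.ini w) → 0 < p' (X.ter w) → X.Slack p' y' w := by
  have hV : ∀ᶠ ε : ℝ in nhdsWithin 0 (Set.Ioi 0), ∀ v,
      0 < p v ∨ 0 < q v → 0 < p v + ε * (q v + ε * 0) := by
    refine Filter.eventually_all.2 fun v => ?_
    by_cases hv : 0 < p v ∨ 0 < q v
    · refine (eventually_quadratic_pos (m := 0) ?_).mono fun ε h _ => h
      rcases (h.nonneg v).eq_or_lt' with h0 | h0
      · exact Or.inr ⟨h0, Or.inl (hv.resolve_left (by simp [h0]))⟩
      · exact Or.inl h0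
    · exact Filter.Eventually.of_forall fun ε h => absurd h hv
  have hW : ∀ᶠ ε : ℝ in nhdsWithin 0 (Set.Ioi 0), ∀ w,
      ((p (X.ini w) = 0 ∧ q (X.ini w) = 0 ∨ p (X.ter w) = 0 ∧ q (X.ter w) = 0) ∧ z w = 0) ∨
      X.Slack (fun v => p v + ε * q v) (fun w => y w + ε * z w) w := by
    refine Filter.eventually_all.2 fun w => ?_
    by_cases hw : (p (X.ini w) = 0 ∧ q (X.ini w) = 0 ∨ p (X.ter w) = 0 ∧ q (X.ter w) = 0) ∧
        z w = 0
    · exact Filter.Eventually.of_forall fun ε => Or.inl hw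
    · refine (eventually_quadratic_pos
        (c := p (X.ini w) * p (X.ter w) - (X.b w * y w) ^ 2)
        (l := q (X.ini w) * p (X.ter w) + p (X.ini w) * q (X.ter w) - 2 * X.b w ^ 2 * y w * z w)
        (m := q (X.ini w) * q (X.ter w) - (X.b w * z w) ^ 2) ?_).mono
        fun ε hε => Or.inr ?_
      · rcases (h.bound w).lt_or_eq with hb | hb
        · exact Or.inl (sub_pos.2 hb)
        · refine Or.inr ⟨by rw [hb, sub_self], ?_⟩
          rcases (hedge w).resolve_left hw with h1 | h1 | h1
          · exact absurd hb (ne_of_lt h1)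
          · exact Or.inl h1
          · exact Or.inr ⟨h1.1, sub_pos.2 h1.2⟩
      · unfold Slack
        linarith
  have hpos : ∀ᶠ ε : ℝ in nhdsWithin 0 (Set.Ioi 0), 0 < ε := self_mem_nhdsWithin
  obtain ⟨ε, h1, h2, h3⟩ := (hV.and (hW.and hpos)).exists
  simp only [mul_zero, add_zero] at h1
  have hzero : ∀ v, ¬ (0 < p v ∨ 0 < q v) → p v = 0 ∧ q v = 0 := fun v hv => by
    push Not at hv
    have hp := hv.1.antisymm (h.nonneg v)
    exact ⟨hp, hv.2.antisymm (hq v hp)⟩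
  have hiff : ∀ v, 0 < p v + ε * q v ↔ 0 < p v ∨ 0 < q v := fun v => by
    refine ⟨fun hv => ?_, h1 v⟩
    by_contra h0
    simp [hzero v h0] at hv
  refine ⟨fun v => p v + ε * q v, fun w => y w + ε * z w, ⟨?_, ?_, ?_, ?_⟩, hiff, ?_⟩
  · intro v
    by_cases hv : 0 < p v ∨ 0 < q v
    · exact (h1 v hv).le
    · simp [hzero v hv]
  · intro w
    rw [h.symm, hz]
  · intro w
    rcases h2 w with ⟨hw, hzw⟩ | hw
    · have : p (X.ini w) * p (X.ter w) = 0 := by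
        rcases hw with hw | hw <;> simp [hw]
      rw [h.eq_zero this, hzw]
      rcases hw with hw | hw <;> simp [hw]
    · exact hw.le
  · intro v
    rw [outSum_add, outSum_const_mul, ← hqz, ← h.eqn]; ring
  · intro w hi ht
    rcases h2 w with ⟨hw | hw, -⟩ | hw
    · simp [hw] at hi
    · simp [hw] at ht
    · exact hw

open scoped Classical in
/-- Either all edges in the support can be made slack, or there is a harmonic function
obstructing this. -/
lemma Feasible.exists_slack_or_harmonic {p : V → ℝ} {y : W → ℝ} (h : X.Feasible p y) :
    (∃ (p' : V → ℝ) (y' : W → ℝ), X.Feasible p' y' ∧ (∀ v, 0 < p' v ↔ 0 < p v) ∧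
      ∀ w, 0 < p' (X.ini w) → 0 < p' (X.ter w) → X.Slack p' y' w) ∨
    ∃ x : V → ℝ, (∀ v, X.outSum (fun w => y w * (x (X.ini w) - x (X.ter w))) v = 0) ∧
      (∀ w, X.Slack p y w → x (X.ini w) + x (X.ter w) = 0) ∧
      ∃ w, y w ≠ 0 ∧ x (X.ini w) ≠ 0 := by
  let Φ : (V → ℝ) × (W → ℝ) →ₗ[ℝ] (V → ℝ) :=
    { toFun := fun βh v => X.outSum (fun w => y w * (βh.1 (X.ini w) - βh.1 (X.ter w)) -
        if X.Slack p y w then βh.2 w + βh.2 (X.rev w) else 0) v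
      map_add' := fun f g => by
        funext v
        rw [Pi.add_apply, ← outSum_add]
        congr 1; funext w
        simp only [Prod.fst_add, Prod.snd_add, Pi.add_apply]
        split_ifs <;> ring
      map_smul' := fun c f => by
        funext v
        rw [Pi.smul_apply, smul_eq_mul, RingHom.id_apply, ← outSum_const_mul]
        congr 1; funext w
        simp only [Prod.smul_fst, Prod.smul_snd, Pi.smul_apply, smul_eq_mul]
        split_ifs <;> ring }
  by_cases ht : (fun v => X.outSum (fun w => if X.Slack p y w then 0 else -y w) v) ∈
      LinearMap.range Φ
  · left
    obtain ⟨⟨β, g⟩, hβ⟩ := ht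
    let e : W → ℝ := fun w => if X.Slack p y w then g w + g (X.rev w) else -y w
    have hL : ∀ v, X.outSum (fun w => y w * (β (X.ini w) - β (X.ter w))) v = X.outSum e v := by
      intro v
      have h1 := congrFun hβ v
      simp only [Φ, LinearMap.coe_mk, AddHom.coe_mk] at h1
      rw [outSum_sub, sub_eq_iff_eq_add, ← outSum_add] at h1
      rw [h1]
      congr 1; funext w
      simp only [e]
      split_ifs <;> ring
    refine Exists.elim (h.exists_perturbation
      (q := fun v => p v * (2 * β v)) (z := fun w => e w + y w * (β (X.ini w) + β (X.ter w)))
      ?_ ?_ ?_ ?_) ?_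
    · intro w
      simp only [e, X.slack_rev h.symm, h.symm, X.rev_invol, ini_rev, ter_rev]
      split_ifs <;> ring
    · intro v
      have h1 : (fun w => y w * (β (X.ini w) + β (X.ter w))) = fun w =>
          (fun v => 2 * β v) (X.ini w) * y w - y w * (β (X.ini w) - β (X.ter w)) := by
        funext w; ring
      rw [outSum_add, h1, outSum_sub, X.outSum_ini_mul (fun v => 2 * β v), hL, ← h.eqn]
      ring
    · intro v hv
      simp [hv]
    · intro w
      by_cases h0 : p (X.ini w) * p (X.ter w) = 0
      · have hy := h.eq_zero h0
        have hn : ¬ X.Slack p y w := fun hs => (sq_nonneg _).not_gt (hs.trans_eq h0)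
        refine Or.inl ⟨?_, by simp [e, hn, hy]⟩
        rcases mul_eq_zero.1 h0 with h0 | h0 <;> simp [h0]
      · by_cases hs : X.Slack p y w
        · exact Or.inr (Or.inl hs)
        · refine Or.inr (Or.inr (Or.inl ?_))
          have ht : (X.b w * y w) ^ 2 = p (X.ini w) * p (X.ter w) :=
            (h.bound w).antisymm (not_lt.1 hs)
          have hpos : 0 < p (X.ini w) * p (X.ter w) :=
            (mul_nonneg (h.nonneg _) (h.nonneg _)).lt_of_ne' h0
          simp only [e, if_neg hs]
          have : p (X.ini w) * (2 * β (X.ini w)) * p (X.ter w) +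
              p (X.ini w) * (p (X.ter w) * (2 * β (X.ter w))) -
              2 * X.b w ^ 2 * y w * (-y w + y w * (β (X.ini w) + β (X.ter w))) =
              2 * (p (X.ini w) * p (X.ter w)) := by
            linear_combination (2 - 2 * (β (X.ini w) + β (X.ter w))) * ht
          rw [this]; positivity
    · rintro p' ⟨y', hf, hsupp, hs⟩
      refine ⟨p', y', hf, fun v => ?_, hs⟩
      rw [hsupp]
      refine ⟨fun hv => ?_, Or.inl⟩
      by_contra h0
      have : p v = 0 := (not_lt.1 h0).antisymm (h.nonneg v)
      simp [this] at hv
  · right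
    obtain ⟨f, hft, hf⟩ := Submodule.exists_le_ker_of_notMem ht
    let x : V → ℝ := fun v => f (Pi.single v 1)
    have hfx : ∀ g : V → ℝ, f g = ∑ v, x v * g v := fun g => by
      conv_lhs => rw [pi_eq_sum_univ' g, map_sum]
      refine Finset.sum_congr rfl fun v _ => ?_
      rw [map_smul, smul_eq_mul, mul_comm]
    have hΦ : ∀ β g, ∑ v, x v * Φ (β, g) v = 0 := fun β g => by
      rw [← hfx]; exact hf ⟨_, rfl⟩
    refine ⟨x, fun v => ?_, fun w hw => ?_, ?_⟩
    · have h1 := hΦ (Pi.single v 1) 0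
      simp only [Φ, LinearMap.coe_mk, AddHom.coe_mk, Pi.zero_apply, add_zero, ite_self,
        sub_zero] at h1
      rw [sum_mul_laplacian h.symm] at h1
      simpa [Pi.single_apply] using h1
    · have h1 := hΦ 0 (Pi.single w 1)
      simp only [Φ, LinearMap.coe_mk, AddHom.coe_mk, Pi.zero_apply, sub_zero, mul_zero,
        zero_sub] at h1
      rw [sum_mul_outSum] at h1
      have h2 : ∀ u, x (X.ini u) * -(if X.Slack p y u then
          (Pi.single w 1 : W → ℝ) u + (Pi.single w 1 : W → ℝ) (X.rev u) else 0) =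
          -((if u = w then x (X.ini u) else 0) + if u = X.rev w then x (X.ini u) else 0) := by
        intro u
        simp only [Pi.single_apply, rev_eq_iff]
        by_cases hu : u = w
        · subst hu; simp [hw, (X.rev_ne u).symm]
        · by_cases hu' : u = X.rev w
          · subst hu'; simp [X.slack_rev h.symm, hw, X.rev_ne w]
          · simp [hu, hu']
      simp only [h2] at h1
      rw [Finset.sum_neg_distrib, neg_eq_zero, Finset.sum_add_distrib] at h1
      simpa [ini_rev] using h1
    · by_contra hcon
      push Not at hcon
      apply hft
      rw [hfx, sum_mul_outSum]
      refine Finset.sum_eq_zero fun w _ => ?_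
      by_cases hy : y w = 0
      · simp [hy]
      · simp [hcon w hy]

open scoped Classical in
/-- A feasible point with positive lengths can be made slack everywhere, or replaced by one all
of whose edges are tight or have zero weight. -/
lemma Feasible.slack_or_tight {p : V → ℝ} {y : W → ℝ} (h : X.Feasible p y) (hp : ∀ v, 0 < p v) :
    ∃ (p' : V → ℝ) (y' : W → ℝ), X.Feasible p' y' ∧ (∀ v, 0 < p' v) ∧
      ((∀ w, X.Slack p' y' w) ∨ ∀ w, y' w = 0 ∨ ¬ X.Slack p' y' w) := by
  induction hn : (univ.filter fun w => ¬ X.Slack p y w).card using Nat.strong_induction_on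
    generalizing p y with
  | _ n ih =>
  rcases h.exists_slack_or_harmonic with ⟨p', y', hf, hsupp, hs⟩ | ⟨x, hx, hxs, w₀, -, hw₀⟩
  · have hp' : ∀ v, 0 < p' v := fun v => (hsupp v).2 (hp v)
    exact ⟨p', y', hf, hp', Or.inl fun w => hs w (hp' _) (hp' _)⟩
  by_cases ht : ∃ w, ¬ X.Slack p y w ∧ x (X.ini w) ≠ x (X.ter w)
  · obtain ⟨w₁, hw₁, hne⟩ := ht
    have hslack : ∀ w, X.Slack p y w ∨ x (X.ini w) ≠ x (X.ter w) →
        X.Slack (fun v => p v + (1 + 1 * x v) ^ 2 * p v)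
          (fun w => y w + (1 + 1 * x (X.ini w)) * (1 + 1 * x (X.ter w)) * y w) w := by
      intro w hw
      have hb := h.bound w
      have hpp := mul_pos (hp (X.ini w)) (hp (X.ter w))
      unfold Slack at hw ⊢
      set m := x (X.ini w)
      set n := x (X.ter w)
      have e1 : (X.b w * (y w + (1 + 1 * m) * (1 + 1 * n) * y w)) ^ 2 =
          (X.b w * y w) ^ 2 * (1 + (1 + m) * (1 + n)) ^ 2 := by ring
      have e2 : (p (X.ini w) + (1 + 1 * m) ^ 2 * p (X.ini w)) *
          (p (X.ter w) + (1 + 1 * n) ^ 2 * p (X.ter w)) =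
          p (X.ini w) * p (X.ter w) * (1 + (1 + m) * (1 + n)) ^ 2 +
          p (X.ini w) * p (X.ter w) * (m - n) ^ 2 := by ring
      rw [e1, e2]
      by_cases hmn : m = n
      · have h1 := hw.resolve_right (not_not.2 hmn)
        have h2 : 0 < 1 + (1 + m) * (1 + n) := by rw [hmn]; nlinarith [sq_nonneg (1 + n)]
        rw [hmn, sub_self]
        rw [hmn] at h2
        have : 0 < (1 + (1 + n) * (1 + n)) ^ 2 := by positivity
        nlinarith
      · have h1 : 0 < (m - n) ^ 2 := by have := sub_ne_zero.2 hmn; positivity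
        have h2 := mul_pos hpp h1
        have h3 := mul_le_mul_of_nonneg_right hb (sq_nonneg (1 + (1 + m) * (1 + n)))
        linarith
    refine ih _ ?_ (h.add (h.rescale hx 1))
      (fun v => add_pos_of_pos_of_nonneg (hp v) (mul_nonneg (sq_nonneg _) (hp v).le)) rfl
    rw [← hn]
    apply Finset.card_lt_card
    rw [Finset.ssubset_iff_of_subset]
    · exact ⟨w₁, by simpa using hw₁, by simpa using hslack w₁ (Or.inr hne)⟩
    · intro w hw
      rw [Finset.mem_filter] at hw ⊢
      exact ⟨hw.1, fun hs => hw.2 (hslack w (Or.inl hs))⟩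
  · push Not at ht
    have hsq : ∀ u v, x u ^ 2 = x v ^ 2 := fun u v => by
      induction X.connected u v with
      | refl => rfl
      | tail _ hstep ih' =>
        obtain ⟨w, rfl, rfl⟩ := hstep
        rw [ih', ini_rev]
        by_cases hs : X.Slack p y w
        · rw [eq_neg_of_add_eq_zero_left (hxs w hs), neg_sq]
        · rw [ht w hs]
    have hne : ∀ v, x v ≠ 0 := fun v hv => by
      have := hsq (X.ini w₀) v
      rw [hv] at this
      exact hw₀ (by simpa using this)
    refine ⟨p, fun w => if X.Slack p y w then 0 else y w, ⟨h.nonneg, ?_, ?_, ?_⟩, hp,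
      Or.inr ?_⟩
    · intro w
      simp only [X.slack_rev h.symm, h.symm]
    · intro w
      by_cases hs : X.Slack p y w
      · simpa [hs] using (mul_pos (hp _) (hp _)).le
      · simpa [hs] using h.bound w
    · intro v
      have h1 : (fun w => if X.Slack p y w then 0 else y w) = fun w =>
          y w - (fun v => (2 * x v)⁻¹) (X.ini w) * (y w * (x (X.ini w) - x (X.ter w))) := by
        funext w
        have := hne (X.ini w)
        by_cases hs : X.Slack p y w
        · rw [if_pos hs, eq_neg_of_add_eq_zero_right (hxs w hs)]
          field_simp; ring
        · rw [if_neg hs, ht w hs]; simp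
      rw [h1, outSum_sub, X.outSum_ini_mul (fun v => (2 * x v)⁻¹), hx, mul_zero, sub_zero, h.eqn]
    · intro w
      by_cases hs : X.Slack p y w
      · simp [hs]
      · right
        rwa [Slack, if_neg hs]

open scoped Classical in
/-- Slackness spreads from a nonempty support to the whole graph when every vertex of charge zero
carries a loop. -/
lemma Feasible.exists_pos_slack (hloop : ∀ v, X.k v = 0 → ∃ w, X.ini w = v ∧ X.ter w = v)
    {p : V → ℝ} {y : W → ℝ} (h : X.Feasible p y) (hp : ∃ v, 0 < p v)
    (hs : ∀ w, 0 < p (X.ini w) → 0 < p (X.ter w) → X.Slack p y w) :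
    ∃ (p' : V → ℝ) (y' : W → ℝ), X.Feasible p' y' ∧ (∀ v, 0 < p' v) ∧ ∀ w, X.Slack p' y' w := by
  induction hn : (univ.filter fun v => ¬ 0 < p v).card using Nat.strong_induction_on
    generalizing p y with
  | _ n ih =>
  by_cases hall : ∀ v, 0 < p v
  · exact ⟨p, y, h, hall, fun w => hs w (hall _) (hall _)⟩
  obtain ⟨e, he, he'⟩ : ∃ e, 0 < p (X.ini e) ∧ ¬ 0 < p (X.ter e) := by
    by_contra hcon
    push Not at hcon
    obtain ⟨v₀, hv₀⟩ := hp
    refine hall fun v => ?_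
    induction X.connected v₀ v with
    | refl => exact hv₀
    | tail _ hstep ih' =>
      obtain ⟨w, rfl, rfl⟩ := hstep
      exact hcon w ih'
  have hpt : p (X.ter e) = 0 := (not_lt.1 he').antisymm (h.nonneg _)
  have hne : X.ini e ≠ X.ter e := fun h0 => he' (h0 ▸ he)
  obtain ⟨c, z, hz, hzs, hc⟩ : ∃ (c : ℝ) (z : W → ℝ), (∀ w, z (X.rev w) = z w) ∧
      (∀ w, z w ≠ 0 → X.ini w = X.ini e ∧ X.ter w = X.ini e) ∧
      X.k (X.ini e) * c = X.k (X.ter e) + X.outSum z (X.ini e) := by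
    by_cases hk : X.k (X.ini e) = 0
    · obtain ⟨l, hl, hl'⟩ := hloop _ hk
      refine ⟨0, fun w => (if w = l then -X.k (X.ter e) / 2 else 0) +
        if w = X.rev l then -X.k (X.ter e) / 2 else 0, fun w => ?_, fun w hw => ?_, ?_⟩
      · simp only [rev_eq_iff, X.rev_invol, add_comm]
      · by_cases h1 : w = l
        · subst h1; exact ⟨hl, hl'⟩
        · by_cases h2 : w = X.rev l
          · subst h2; exact ⟨hl', by rw [ter_rev, hl]⟩
          · simp [h1, h2] at hw
      · have hl'' : X.ini (X.rev l) = X.ini e := hl'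
        rw [outSum_add, outSum, outSum, Finset.sum_ite_eq', Finset.sum_ite_eq']
        simp only [Finset.mem_filter, Finset.mem_univ, true_and, hl, hl'', if_true]
        ring
    · exact ⟨X.k (X.ter e) / X.k (X.ini e), 0, fun _ => rfl, fun w hw => absurd rfl hw, by
        simp [outSum, mul_div_cancel₀ _ hk]⟩
  let q : V → ℝ := fun v => if v = X.ini e then c else if v = X.ter e then 1 else 0
  let d : W → ℝ := fun w => (if w = e then X.k (X.ter e) else 0) +
    if w = X.rev e then X.k (X.ter e) else 0
  have hqi : q (X.ini e) = c := by simp [q]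
  have hqt : q (X.ter e) = 1 := by simp [q, hne.symm]
  have hpos : ∀ v, v ≠ X.ter e → ¬ 0 < p v → p v = 0 ∧ q v = 0 := fun v hv hv' => by
    have : v ≠ X.ini e := fun h0 => hv' (h0 ▸ he)
    exact ⟨(not_lt.1 hv').antisymm (h.nonneg _), by simp [q, hv, this]⟩
  have hzw : ∀ w, ¬ (0 < p (X.ini w) ∧ 0 < p (X.ter w)) → z w = 0 := fun w hw => by
    by_contra h0
    obtain ⟨h1, h2⟩ := hzs w h0
    exact hw ⟨h1 ▸ he, h2 ▸ he⟩
  refine Exists.elim (h.exists_perturbation (q := q) (z := fun w => d w + z w) ?_ ?_ ?_ ?_) ?_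
  · intro w
    simp only [d, rev_eq_iff, X.rev_invol, hz, add_comm]
  · intro v
    rw [outSum_add, outSum_add]
    rw [outSum, outSum, Finset.sum_ite_eq', Finset.sum_ite_eq']
    simp only [Finset.mem_filter, Finset.mem_univ, true_and, ini_rev]
    have hz0 : v ≠ X.ini e → X.outSum z v = 0 := fun hv =>
      Finset.sum_eq_zero fun w hw => by
        by_contra h0
        exact hv ((Finset.mem_filter.1 hw).2 ▸ (hzs w h0).1)
    by_cases h1 : v = X.ini e
    · subst h1
      rw [hqi, hc]; simp [hne.symm]
    · rw [hz0 h1]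
      by_cases h2 : v = X.ter e
      · subst h2
        rw [hqt]; simp [hne]
      · simp [q, h1, h2, Ne.symm h1, Ne.symm h2]
  · intro v hv
    by_cases h1 : v = X.ter e
    · rw [h1, hqt]; exact zero_le_one
    · rw [(hpos v h1 (by simp [hv])).2]
  · intro w
    by_cases hi : 0 < p (X.ini w) <;> by_cases ht : 0 < p (X.ter w)
    · exact Or.inr (Or.inl (hs w hi ht))
    · have hpw : p (X.ter w) = 0 := (not_lt.1 ht).antisymm (h.nonneg _)
      have hy : y w = 0 := h.eq_zero (by simp [hpw])
      by_cases hw : X.ter w = X.ter e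
      · refine Or.inr (Or.inr (Or.inl ?_))
        rw [hy, hpw, hw, hqt]; simpa using hi
      · refine Or.inl ⟨Or.inr (hpos _ hw ht), ?_⟩
        have h1 : w ≠ e := fun h0 => hw (by rw [h0])
        have h2 : w ≠ X.rev e := fun h0 => he' (by rwa [h0, ini_rev] at hi)
        simp [d, h1, h2, hzw w (fun h0 => ht h0.2)]
    · have hpw : p (X.ini w) = 0 := (not_lt.1 hi).antisymm (h.nonneg _)
      have hy : y w = 0 := h.eq_zero (by simp [hpw])
      by_cases hw : X.ini w = X.ter e
      · refine Or.inr (Or.inr (Or.inl ?_))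
        rw [hy, hpw, hw, hqt]; simpa using ht
      · refine Or.inl ⟨Or.inl (hpos _ hw hi), ?_⟩
        have h1 : w ≠ e := fun h0 => hi (by rwa [h0])
        have h2 : w ≠ X.rev e := fun h0 => hw (by rw [h0, ini_rev])
        simp [d, h1, h2, hzw w (fun h0 => hi h0.1)]
    · have h1 : w ≠ e := fun h0 => hi (by rwa [h0])
      have h2 : w ≠ X.rev e := fun h0 => ht (by rwa [h0, ter_rev])
      have h3 : d w + z w = 0 := by simp [d, h1, h2, hzw w (fun h0 => ht h0.2)]
      by_cases hw : X.ini w = X.ter e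
      · by_cases hw' : X.ter w = X.ter e
        · refine Or.inr (Or.inr (Or.inr ?_))
          simp only [h3, hw, hw', hqt, hpt]
          norm_num
        · exact Or.inl ⟨Or.inr (hpos _ hw' ht), h3⟩
      · exact Or.inl ⟨Or.inl (hpos _ hw hi), h3⟩
  · rintro p' ⟨y', hf, hsupp, hs'⟩
    refine ih _ ?_ hf ⟨X.ini e, (hsupp _).2 (Or.inl he)⟩ hs' rfl
    rw [← hn]
    apply Finset.card_lt_card
    rw [Finset.ssubset_iff_of_subset]
    · exact ⟨X.ter e, by simpa using he', by simp [hsupp, hqt]⟩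
    · intro v hv
      rw [Finset.mem_filter] at hv ⊢
      exact ⟨hv.1, fun h0 => hv.2 ((hsupp v).2 (Or.inl h0))⟩

open scoped Classical in
/-- A nonzero feasible point can be replaced by one that is slack everywhere with positive
lengths, or by one all of whose edges are tight. -/
lemma Feasible.pos_slack_or_tight {p : V → ℝ} {y : W → ℝ} (h : X.Feasible p y)
    (hp : ∃ v, 0 < p v) :
    ∃ (p' : V → ℝ) (y' : W → ℝ), X.Feasible p' y' ∧ (∃ v, 0 < p' v) ∧
      ((∀ v, 0 < p' v) ∧ (∀ w, X.Slack p' y' w) ∨ ∀ w, ¬ X.Slack p' y' w) := by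
  by_cases hloop : ∀ v, X.k v = 0 → ∃ w, X.ini w = v ∧ X.ter w = v
  swap
  · push Not at hloop
    obtain ⟨v, hk, hv⟩ := hloop
    have hprod : ∀ w,
        (Pi.single v 1 : V → ℝ) (X.ini w) * (Pi.single v 1 : V → ℝ) (X.ter w) = 0 := by
      intro w
      by_cases h1 : X.ini w = v
      · simp [Pi.single_apply, hv w h1]
      · simp [Pi.single_apply, h1]
    refine ⟨Pi.single v 1, 0, ⟨fun u => ?_, fun _ => rfl, fun w => ?_, fun u => ?_⟩,
      ⟨v, by simp⟩, Or.inr fun w => ?_⟩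
    · rw [Pi.single_apply]; split_ifs <;> norm_num
    · simp [hprod]
    · by_cases hu : u = v
      · subst hu; simp [hk, outSum]
      · simp [hu, outSum]
    · simp [Slack, hprod]
  induction hn : (univ.filter fun v => 0 < p v).card using Nat.strong_induction_on
    generalizing p y with
  | _ n ih =>
  by_cases htight : ∀ w, ¬ X.Slack p y w
  · exact ⟨p, y, h, hp, Or.inr htight⟩
  push Not at htight
  obtain ⟨e, he⟩ := htight
  rcases h.exists_slack_or_harmonic with ⟨p', y', hf, hsupp, hs⟩ | ⟨x, hx, hxs, w₀, hy₀, hw₀⟩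
  · obtain ⟨p', y', hf, hp', hs⟩ :=
      hf.exists_pos_slack hloop (hp.imp fun v => (hsupp v).2) hs
    exact ⟨p', y', hf, ⟨X.ini e, hp' _⟩, Or.inl ⟨hp', hs⟩⟩
  · set u := X.ini w₀
    have hu : 0 < p u := by
      refine (h.nonneg u).lt_of_ne' fun h0 => hy₀ (h.eq_zero ?_)
      rw [show p (X.ini w₀) = 0 from h0, zero_mul]
    obtain ⟨v, hv, hvu⟩ : ∃ v, 0 < p v ∧ x v ≠ x u := by
      obtain ⟨h1, h2⟩ := h.pos_of_slack he
      by_cases h3 : x (X.ini e) = x u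
      · refine ⟨_, h2, fun h4 => hw₀ ?_⟩
        have := hxs e he
        rw [h3, h4] at this
        linarith
      · exact ⟨_, h1, h3⟩
    have hzero : 1 + -(x u)⁻¹ * x u = 0 := by field_simp; ring
    refine ih _ ?_ (h.rescale hx (-(x u)⁻¹)) ⟨v, ?_⟩ rfl
    · rw [← hn]
      apply Finset.card_lt_card
      rw [Finset.ssubset_iff_of_subset]
      · exact ⟨u, by simpa using hu, by rw [Finset.mem_filter, hzero]; simp⟩
      · intro v hv
        rw [Finset.mem_filter] at hv ⊢
        exact ⟨hv.1, pos_of_mul_pos_right hv.2 (sq_nonneg _)⟩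
    · have : 1 + -(x u)⁻¹ * x v ≠ 0 := by
        intro h0
        apply hvu
        field_simp at h0
        linarith
      positivity

/-- A feasible point that is slack everywhere gives an NPC-solution. -/
lemma Feasible.exists_npcSolution {p : V → ℝ} {y : W → ℝ} (h : X.Feasible p y)
    (hp : ∀ v, 0 < p v) (hs : ∀ w, X.Slack p y w) : ∃ a γ, X.NPCSolution a γ := by
  obtain ⟨w₀⟩ := X.edges_nonempty
  obtain ⟨a, γ, h1, h2, h3, ha, hγ⟩ := h.exists_solution ⟨X.ini w₀, hp _⟩
  refine ⟨a, γ, h1, h2, h3, fun v => by rw [ha]; exact Real.sqrt_pos.2 (hp v), fun w => ?_⟩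
  rw [← sq_lt_one_iff_abs_lt_one]
  have h4 := hs w
  rw [Slack, ← (hγ w).1] at h4
  have := mul_pos (hp (X.ini w)) (hp (X.ter w))
  by_contra h5
  nlinarith

lemma Feasible.eq_one_or_neg_one_of_not_slack {p : V → ℝ} {y : W → ℝ} (h : X.Feasible p y)
    {w : W} (hs : ¬ X.Slack p y w) (hw : p (X.ini w) * p (X.ter w) ≠ 0) {c : ℝ}
    (hc : c ^ 2 * (p (X.ini w) * p (X.ter w)) = (X.b w * y w) ^ 2) : c = 1 ∨ c = -1 := by
  rw [(h.bound w).antisymm (not_lt.1 hs)] at hc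
  exact sq_eq_one_iff.1 (mul_right_cancel₀ hw (by rw [hc, one_mul]))

end LabeledGraph

open LabeledGraph in
/-- If the BKN-equation over `X` has a compatible symmetric solution, then it has one
`(a',γ')` which is either (1) an NPC-solution, or (2) has `γ'` valued in `{0,±1}` with
`|γ'_w| = 1` whenever `a'_{w⁻}·a'_{w⁺} ≠ 0`. Moreover, if there is a compatible symmetric
solution with positive length function, then there is one satisfying (1) or (3): positive
length function and `γ'` valued in `{0,±1}`. -/
theorem compatible_symmetric_solution_dichotomy
    {V W : Type} [Fintype V] [DecidableEq V] [Fintype W] [DecidableEq W]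
    (X : LabeledGraph V W) :
    ((∃ (a : V → ℝ) (γ : W → ℝ), X.BKN a γ ∧ X.Compatible a γ ∧ X.SymSol γ) →
      ∃ (a' : V → ℝ) (γ' : W → ℝ), X.BKN a' γ' ∧ X.Compatible a' γ' ∧ X.SymSol γ' ∧
        (X.NPCSolution a' γ' ∨
          ((∀ w, γ' w = 0 ∨ γ' w = 1 ∨ γ' w = -1) ∧
            ∀ w, a' (X.ini w) * a' (X.ter w) ≠ 0 → γ' w = 1 ∨ γ' w = -1))) ∧
    ((∃ (a : V → ℝ) (γ : W → ℝ), X.BKN a γ ∧ X.Compatible a γ ∧ X.SymSol γ ∧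
        ∀ v, 0 < a v) →
      ∃ (a' : V → ℝ) (γ' : W → ℝ), X.BKN a' γ' ∧ X.Compatible a' γ' ∧ X.SymSol γ' ∧
        (X.NPCSolution a' γ' ∨
          ((∀ v, 0 < a' v) ∧ ∀ w, γ' w = 0 ∨ γ' w = 1 ∨ γ' w = -1))) := by
  refine ⟨?_, ?_⟩
  · rintro ⟨a, γ, h1, h2, h3⟩
    obtain ⟨y, hf⟩ := exists_feasible h1 h2 h3
    obtain ⟨v, hv⟩ := Function.ne_iff.1 h2.2.1
    obtain ⟨p', y', hf', hp', ⟨hpos, hs⟩ | ht⟩ :=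
      hf.pos_slack_or_tight ⟨v, pow_pos ((h2.1 v).lt_of_ne' hv) 2⟩
    · obtain ⟨a', γ', h⟩ := hf'.exists_npcSolution hpos hs
      exact ⟨a', γ', h.1, h.2.1, h.2.2.1, Or.inl h⟩
    · obtain ⟨a', γ', h1, h2, h3, ha, hγ⟩ := hf'.exists_solution hp'
      refine ⟨a', γ', h1, h2, h3, Or.inr ⟨fun w => ?_, fun w hw => ?_⟩⟩
      · by_cases hw : p' (X.ini w) * p' (X.ter w) = 0
        · exact Or.inl ((hγ w).2 (hf'.eq_zero hw))
        · exact Or.inr (hf'.eq_one_or_neg_one_of_not_slack (ht w) hw (hγ w).1)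
      · refine hf'.eq_one_or_neg_one_of_not_slack (ht w) (fun h0 => hw ?_) (hγ w).1
        rw [ha, ha, ← Real.sqrt_mul (hf'.nonneg _), h0, Real.sqrt_zero]
  · rintro ⟨a, γ, h1, h2, h3, hpos⟩
    obtain ⟨y, hf⟩ := exists_feasible h1 h2 h3
    obtain ⟨p', y', hf', hp', hs | ht⟩ := hf.slack_or_tight fun v => pow_pos (hpos v) 2
    · obtain ⟨a', γ', h⟩ := hf'.exists_npcSolution hp' hs
      exact ⟨a', γ', h.1, h.2.1, h.2.2.1, Or.inl h⟩
    · obtain ⟨w₀⟩ := X.edges_nonempty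
      obtain ⟨a', γ', h1, h2, h3, ha, hγ⟩ := hf'.exists_solution ⟨X.ini w₀, hp' _⟩
      refine ⟨a', γ', h1, h2, h3, Or.inr ⟨fun v => ?_, fun w => ?_⟩⟩
      · rw [ha]; exact Real.sqrt_pos.2 (hp' v)
      · rcases ht w with hw | hw
        · exact Or.inl ((hγ w).2 hw)
        · exact Or.inr (hf'.eq_one_or_neg_one_of_not_slack hw
            (mul_pos (hp' _) (hp' _)).ne' (hγ w).1)
end

section
/- Let V be a finite set partitioned into two disjoint subsets V = V₀ ⊔ V₁, let k : V → ℚ be rational numbers, and suppose there is a four-element subset U ⊆ V₀ on which k is constant with nonzero value. Let Q = {x ∈ ℝ^V : Σ_{v∈V₀} k_v·x_v² = Σ_{v∈V₁} k_v·x_v²}. Then the points of Q all of whose coordinates are rational are dense in Q. -/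
open Finset

/-- Every nonnegative rational number is a sum of four rational squares. -/
theorem exists_sum_sq_eq_of_card_eq_four {ι : Type*} [Fintype ι] (hι : Fintype.card ι = 4)
    {r : ℚ} (hr : 0 ≤ r) : ∃ p : ι → ℚ, ∑ i, p i ^ 2 = r := by
  obtain ⟨a, b, c, d, h⟩ := Nat.sum_four_squares (r.num.toNat * r.den)
  have hden : (r.den : ℚ) ≠ 0 := by exact_mod_cast r.den_nz
  have hnum : ((r.num.toNat : ℕ) : ℚ) = r * r.den := by
    rw [Rat.mul_den_eq_num]
    exact_mod_cast Int.toNat_of_nonneg (Rat.num_nonneg.mpr hr)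
  have h' : (a : ℚ) ^ 2 + b ^ 2 + c ^ 2 + d ^ 2 = r * r.den * r.den := by
    rw [← hnum]
    exact_mod_cast h
  refine ⟨fun i => (![a, b, c, d] (Fintype.equivFinOfCardEq hι i) : ℚ) / r.den, ?_⟩
  rw [(Fintype.equivFinOfCardEq hι).sum_comp
    (fun j => ((![a, b, c, d] j : ℚ) / r.den) ^ 2)]
  simp only [Fin.sum_univ_four, Matrix.cons_val]
  field_simp
  linarith

/-- A reflection in a nonzero vector preserves the sum of squares. -/
theorem sum_sq_reflection {ι K : Type*} [Fintype ι] [Field K] (p w : ι → K)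
    (hw : ∑ i, w i ^ 2 ≠ 0) :
    ∑ i, (p i - 2 * (∑ j, p j * w j) / (∑ j, w j ^ 2) * w i) ^ 2 = ∑ i, p i ^ 2 := by
  set s := 2 * (∑ j, p j * w j) / (∑ j, w j ^ 2) with hs
  have hsw : s * ∑ j, w j ^ 2 = 2 * ∑ j, p j * w j := by
    rw [hs, div_mul_cancel₀ _ hw]
  have hexp : ∑ i, (p i - s * w i) ^ 2 =
      ∑ i, p i ^ 2 - 2 * s * ∑ i, p i * w i + s ^ 2 * ∑ i, w i ^ 2 := by
    simp only [mul_sum, ← sum_sub_distrib, ← sum_add_distrib]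
    exact sum_congr rfl fun i _ => by ring
  rw [hexp]
  linear_combination s * hsw

/-- On a sphere centred at the origin that carries a rational point, the rational points are
dense. -/
theorem exists_rat_near_on_sphere {ι : Type*} [Fintype ι] (p : ι → ℚ) (x : ι → ℝ)
    (hpx : ∑ i, (p i : ℝ) ^ 2 = ∑ i, x i ^ 2) {ε : ℝ} (hε : 0 < ε) :
    ∃ z : ι → ℚ, ∑ i, z i ^ 2 = ∑ i, p i ^ 2 ∧ ∀ i, |(z i : ℝ) - x i| < ε := by
  by_cases hne : ∀ i, (p i : ℝ) = x i
  · exact ⟨p, rfl, fun i => by simpa [hne i] using hε⟩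
  push Not at hne
  obtain ⟨j, hj⟩ := hne
  let N : (ι → ℝ) → ℝ := fun w => ∑ i, w i ^ 2
  let f : (ι → ℝ) → ι → ℝ := fun w i => p i - 2 * (∑ j, (p j : ℝ) * w j) / N w * w i
  let w₀ : ι → ℝ := fun i => p i - x i
  have hN : Continuous N := by fun_prop
  have hw₀ : N w₀ ≠ 0 := by
    refine (sum_pos' (fun i _ => sq_nonneg _) ⟨j, mem_univ j, ?_⟩).ne'
    exact sq_pos_of_ne_zero (sub_ne_zero.mpr hj)
  have hf : ContinuousAt f w₀ := by
    refine continuousAt_pi.mpr fun i => ?_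
    refine continuousAt_const.sub (ContinuousAt.mul (ContinuousAt.div ?_ hN.continuousAt hw₀) ?_)
    · exact Continuous.continuousAt (by fun_prop)
    · exact Continuous.continuousAt (by fun_prop)
  have hfw₀ : f w₀ = x := by
    have hinner : 2 * ∑ i, (p i : ℝ) * w₀ i = N w₀ := by
      have : N w₀ = 2 * ∑ i, (p i : ℝ) * w₀ i - ∑ i, (p i : ℝ) ^ 2 + ∑ i, x i ^ 2 := by
        simp only [N, w₀, mul_sum, ← sum_sub_distrib, ← sum_add_distrib]
        exact sum_congr rfl fun i _ => by ring
      linarith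
    funext i
    simp only [f, hinner, div_self hw₀, w₀]
    ring
  have hnear : ∀ᶠ w in nhds w₀, N w ≠ 0 ∧ dist (f w) x < ε := by
    refine (hN.continuousAt.eventually_ne hw₀).and ?_
    have := hf.eventually (Metric.ball_mem_nhds (f w₀) hε)
    rwa [hfw₀] at this
  have hdense : DenseRange (fun (q : ι → ℚ) (i : ι) => (q i : ℝ)) :=
    DenseRange.piMap fun _ => Rat.denseRange_cast
  obtain ⟨_, ⟨hNw, hfw⟩, w, rfl⟩ := mem_closure_iff_nhds.mp (hdense w₀) _ hnear
  refine ⟨fun i => p i - 2 * (∑ j, p j * w j) / (∑ j, w j ^ 2) * w i,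
    sum_sq_reflection p w fun h => hNw ?_, fun i => ?_⟩
  · simp only [N]
    exact_mod_cast h
  · have := (dist_le_pi_dist _ _ i).trans_lt hfw
    rw [Real.dist_eq] at this
    simpa [f, N] using this

/-- A real vector whose sum of squares is slightly below `r` is close to one whose sum of squares
is exactly `r`. -/
theorem exists_near_sum_sq_eq {ι : Type*} [Fintype ι] [DecidableEq ι] [Nonempty ι] (x : ι → ℝ)
    {r ε : ℝ} (hε : 0 < ε) (hr : ∑ i, x i ^ 2 ≤ r) (hrε : r < ∑ i, x i ^ 2 + ε ^ 2) :
    ∃ x' : ι → ℝ, ∑ i, x' i ^ 2 = r ∧ ∀ i, |x' i - x i| < ε := by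
  obtain ⟨j⟩ := ‹Nonempty ι›
  obtain ⟨t, ht, htx⟩ : ∃ t : ℝ, t ^ 2 = x j ^ 2 + (r - ∑ i, x i ^ 2) ∧ |t - x j| < ε := by
    set s := √(x j ^ 2 + (r - ∑ i, x i ^ 2)) with hs
    have hs2 : s ^ 2 = x j ^ 2 + (r - ∑ i, x i ^ 2) :=
      Real.sq_sqrt (by nlinarith [sq_nonneg (x j)])
    have hs0 : 0 ≤ s := Real.sqrt_nonneg _
    rcases le_total 0 (x j) with h | h
    · refine ⟨s, hs2, abs_lt.mpr ⟨?_, ?_⟩⟩ <;> nlinarith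
    · refine ⟨-s, by rw [neg_sq, hs2], abs_lt.mpr ⟨?_, ?_⟩⟩ <;> nlinarith
  refine ⟨Function.update x j t, ?_, fun i => ?_⟩
  · have h₁ := add_sum_erase univ (fun i => Function.update x j t i ^ 2) (mem_univ j)
    have h₂ := add_sum_erase univ (fun i => x i ^ 2) (mem_univ j)
    have h₃ : ∑ i ∈ univ.erase j, Function.update x j t i ^ 2 = ∑ i ∈ univ.erase j, x i ^ 2 :=
      sum_congr rfl fun i hi => by rw [Function.update_of_ne (ne_of_mem_erase hi)]
    simp only [Function.update_self] at h₁
    linarith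
  · rcases eq_or_ne i j with rfl | hij
    · simpa using htx
    · simpa [Function.update_of_ne hij] using hε

/-- A real number has rational approximations `q` along which `b * q ^ 2` does not decrease. -/
theorem exists_rat_near_mul_sq_ge (b x : ℝ) {ε : ℝ} (hε : 0 < ε) :
    ∃ q : ℚ, |(q : ℝ) - x| < ε ∧ b * x ^ 2 ≤ b * (q : ℝ) ^ 2 ∧
      b * (q : ℝ) ^ 2 < b * x ^ 2 + ε := by
  wlog hx : 0 ≤ x generalizing x
  · obtain ⟨q, h₁, h₂, h₃⟩ := this (-x) (by linarith)
    refine ⟨-q, ?_, by simpa using h₂, by simpa using h₃⟩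
    rw [← abs_neg]
    push_cast
    convert h₁ using 2
    ring
  rcases hx.eq_or_lt with rfl | hx
  · exact ⟨0, by simpa using hε⟩
  have hcont : ContinuousAt (fun t : ℝ => b * t ^ 2) x := by fun_prop
  have hev : ∀ᶠ t in nhds x, b * t ^ 2 < b * x ^ 2 + ε :=
    hcont.eventually_lt continuousAt_const (by linarith)
  obtain ⟨δ, hδ, hball⟩ := Metric.eventually_nhds_iff.mp hev
  have hm : 0 < min ε (min δ x) := by positivity
  have hmε := min_le_left ε (min δ x)
  have hmδ := (min_le_right ε (min δ x)).trans (min_le_left δ x)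
  have hmx := (min_le_right ε (min δ x)).trans (min_le_right δ x)
  set m := min ε (min δ x)
  rcases le_total 0 b with hb | hb
  · obtain ⟨q, hq₁, hq₂⟩ := exists_rat_btwn (show x < x + m by linarith)
    have hqx : |(q : ℝ) - x| < m := abs_lt.mpr ⟨by linarith, by linarith⟩
    exact ⟨q, hqx.trans_le hmε,
      mul_le_mul_of_nonneg_left (pow_le_pow_left₀ hx.le hq₁.le 2) hb,
      hball (by simpa [Real.dist_eq] using hqx.trans_le hmδ)⟩
  · obtain ⟨q, hq₁, hq₂⟩ := exists_rat_btwn (show x - m < x by linarith)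
    have hqx : |(q : ℝ) - x| < m := abs_lt.mpr ⟨by linarith, by linarith⟩
    exact ⟨q, hqx.trans_le hmε,
      mul_le_mul_of_nonpos_left (pow_le_pow_left₀ (by linarith) hq₂.le 2) hb,
      hball (by simpa [Real.dist_eq] using hqx.trans_le hmδ)⟩

/-- Four-dimensional real vectors are approximated by rational vectors with a prescribed rational
sum of squares. -/
theorem exists_rat_near_sum_sq_eq {ι : Type*} [Fintype ι] [DecidableEq ι]
    (hι : Fintype.card ι = 4) (x : ι → ℝ) {r : ℚ} {ε : ℝ} (hε : 0 < ε)
    (hr : ∑ i, x i ^ 2 ≤ r) (hrε : r < ∑ i, x i ^ 2 + (ε / 2) ^ 2) :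
    ∃ z : ι → ℚ, ∑ i, z i ^ 2 = r ∧ ∀ i, |(z i : ℝ) - x i| < ε := by
  have : Nonempty ι := Fintype.card_pos_iff.mp (by omega)
  have hr0 : (0 : ℝ) ≤ r := (sum_nonneg fun i _ => sq_nonneg (x i)).trans hr
  obtain ⟨x', hx', hxx'⟩ := exists_near_sum_sq_eq x (half_pos hε) hr hrε
  obtain ⟨p, hp⟩ := exists_sum_sq_eq_of_card_eq_four hι (Rat.cast_nonneg.mp hr0)
  obtain ⟨z, hz, hzx'⟩ := exists_rat_near_on_sphere p x'
    (by rw [hx', ← hp]; push_cast; rfl) (half_pos hε)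
  refine ⟨z, hz.trans hp, fun i => ?_⟩
  have := abs_sub_le (z i : ℝ) (x' i) (x i)
  linarith [hxx' i, hzx' i]

/-- Let `V` be a finite set partitioned into `V₀ ⊔ V₁`, let `k : V → ℚ`, and suppose some
four-element subset `U ⊆ V₀` carries a constant nonzero value of `k`. Then in the set
`Q = {x ∈ ℝ^V : Σ_{v∈V₀} k_v·x_v² = Σ_{v∈V₁} k_v·x_v²}` the points with all coordinates
rational are dense (in the sense that every point of `Q` is approximated within any `ε > 0`
coordinatewise by rational points of `Q`). -/
theorem rational_points_dense_in_quadric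
    {V : Type} [Fintype V] [DecidableEq V]
    (V₀ V₁ : Finset V) (hdisj : Disjoint V₀ V₁) (hunion : V₀ ∪ V₁ = Finset.univ)
    (k : V → ℚ)
    (U : Finset V) (hUsub : U ⊆ V₀) (hUcard : U.card = 4)
    (c : ℚ) (hc : c ≠ 0) (hconst : ∀ v ∈ U, k v = c) :
    ∀ x : V → ℝ,
      (∑ v ∈ V₀, (k v : ℝ) * x v ^ 2 = ∑ v ∈ V₁, (k v : ℝ) * x v ^ 2) →
      ∀ ε > (0 : ℝ), ∃ y : V → ℝ,
        (∑ v ∈ V₀, (k v : ℝ) * y v ^ 2 = ∑ v ∈ V₁, (k v : ℝ) * y v ^ 2) ∧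
        (∀ v, ∃ q : ℚ, y v = q) ∧ ∀ v, |y v - x v| < ε := by
  intro x hx ε hε
  let a : V → ℚ := fun v => if v ∈ V₀ then k v else -k v
  have hquadric : ∀ y : V → ℝ,
      (∑ v ∈ V₀, (k v : ℝ) * y v ^ 2 = ∑ v ∈ V₁, (k v : ℝ) * y v ^ 2) ↔
        ∑ u ∈ U, y u ^ 2 = ∑ v ∈ Uᶜ, ((-a v / c : ℚ) : ℝ) * y v ^ 2 := by
    intro y
    have hcR : (c : ℝ) ≠ 0 := by exact_mod_cast hc
    have h₀ : ∑ v ∈ V₀, (a v : ℝ) * y v ^ 2 = ∑ v ∈ V₀, (k v : ℝ) * y v ^ 2 :=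
      sum_congr rfl fun v hv => by simp [a, hv]
    have h₁ : ∑ v ∈ V₁, (a v : ℝ) * y v ^ 2 = -∑ v ∈ V₁, (k v : ℝ) * y v ^ 2 := by
      rw [← sum_neg_distrib]
      exact sum_congr rfl fun v hv => by simp [a, disjoint_right.mp hdisj hv]
    have hU : ∑ u ∈ U, (a u : ℝ) * y u ^ 2 = c * ∑ u ∈ U, y u ^ 2 := by
      rw [mul_sum]
      exact sum_congr rfl fun v hv => by simp [a, hUsub hv, hconst v hv]
    have hUc : ∑ v ∈ Uᶜ, ((-a v / c : ℚ) : ℝ) * y v ^ 2 =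
        -(∑ v ∈ Uᶜ, (a v : ℝ) * y v ^ 2) / c := by
      rw [← sum_neg_distrib, sum_div]
      exact sum_congr rfl fun v _ => by push_cast; ring
    have hsplit := sum_add_sum_compl U fun v => (a v : ℝ) * y v ^ 2
    rw [← hunion, sum_union hdisj, h₀, h₁, hU] at hsplit
    rw [hUc, eq_div_iff hcR]
    constructor <;> intro h <;> linarith
  rw [hquadric] at hx
  let δ : ℝ := min ε ((ε / 2) ^ 2 / (Fintype.card V + 1))
  have hδ : 0 < δ := by positivity
  choose q hqx hq_ge hq_lt using
    fun v => exists_rat_near_mul_sq_ge ((-a v / c : ℚ) : ℝ) (x v) hδ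
  let r : ℚ := ∑ v ∈ Uᶜ, -a v / c * q v ^ 2
  have hrcast : (r : ℝ) = ∑ v ∈ Uᶜ, ((-a v / c : ℚ) : ℝ) * (q v : ℝ) ^ 2 := by
    simp only [r]
    push_cast
    rfl
  have hr_ge : ∑ u : U, x u ^ 2 ≤ r := by
    rw [sum_coe_sort U (fun u => x u ^ 2), hx, hrcast]
    exact sum_le_sum fun v _ => hq_ge v
  have hr_lt : r < ∑ u : U, x u ^ 2 + (ε / 2) ^ 2 := by
    rw [sum_coe_sort U (fun u => x u ^ 2), hx, hrcast]
    have h₁ : ∑ v ∈ Uᶜ, ((-a v / c : ℚ) : ℝ) * (q v : ℝ) ^ 2 ≤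
        ∑ v ∈ Uᶜ, (((-a v / c : ℚ) : ℝ) * x v ^ 2 + δ) := sum_le_sum fun v _ => (hq_lt v).le
    rw [sum_add_distrib, sum_const, nsmul_eq_mul] at h₁
    have h₂ : ((Uᶜ.card : ℕ) : ℝ) ≤ Fintype.card V := by exact_mod_cast card_le_univ _
    have h₃ : δ * (Fintype.card V + 1) ≤ (ε / 2) ^ 2 :=
      (le_div_iff₀ (by positivity)).mp (min_le_right _ _)
    nlinarith
  obtain ⟨z, hz, hzx⟩ :=
    exists_rat_near_sum_sq_eq (by simpa using hUcard) (fun u : U => x u) hε hr_ge hr_lt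
  let y : V → ℚ := fun v => if h : v ∈ U then z ⟨v, h⟩ else q v
  refine ⟨fun v => y v, (hquadric _).mpr ?_, fun v => ⟨y v, rfl⟩, fun v => ?_⟩
  · have hyU : ∑ u ∈ U, (y u : ℝ) ^ 2 = r := by
      rw [← sum_coe_sort, ← hz]
      push_cast
      exact sum_congr rfl fun u _ => by simp [y]
    rw [hyU, hrcast]
    exact sum_congr rfl fun v hv => by simp [y, mem_compl.mp hv]
  · by_cases hv : v ∈ U
    · simpa [y, hv] using hzx ⟨v, hv⟩
    · simpa [y, hv] using (hqx v).trans_le (min_le_left _ _)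
end
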